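/- arXiv:2603.28281 — 4 statements merged into one kernel-verified Lean document; each statement's English description precedes it below -/
import Mathlib

section
/- Consider a finite-horizon two-component-action Markov decision process and its best-response value functions V†_h as defined in the context. Suppose Q̄_h : S → (A₁ × A₂) → ℝ are given for h < H, define V̄†_H(s) = 0 and V̄†_h(s) = max_{a₁ ∈ A₁} E_{a₂∼π₂,h(s)}[Q̄_h(s,(a₁,a₂))], and assume that for all h < H, s ∈ S, a₁ ∈ A₁, a₂ ∈ A₂, Q̄_h(s,(a₁,a₂)) ≥ R_h(s,(a₁,a₂)) + E_{s'∼P_h(s,(a₁,a₂))}[V̄†_{h+1}(s')]. Then V̄†_h(s) ≥ V†_h(s) for every h ≤ H and every s ∈ S. -/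
/-- Optimism direction of the robust value-function estimation lemma for
best-response values: in a finite-horizon two-component-action MDP, optimistic
estimates built from Q-functions whose Bellman error is nonpositive upper-bound
the true best-response value functions. -/
theorem stmt_3
    {S A₁ A₂ : Type*} [Fintype S] [Fintype A₁] [Fintype A₂]
    [Nonempty S] [Nonempty A₁] [Nonempty A₂]
    (H : ℕ)
    (P : ℕ → S → A₁ × A₂ → S → ℝ) (R : ℕ → S → A₁ × A₂ → ℝ)
    (π₂ : ℕ → S → A₂ → ℝ)
    (hP : ∀ h < H, ∀ s a, (∀ s', 0 ≤ P h s a s') ∧ ∑ s', P h s a s' = 1)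
    (hπ₂ : ∀ h < H, ∀ s, (∀ a₂, 0 ≤ π₂ h s a₂) ∧ ∑ a₂, π₂ h s a₂ = 1)
    (Vd : ℕ → S → ℝ)
    (hVdH : ∀ s, Vd H s = 0)
    (hVd : ∀ h < H, ∀ s,
      Vd h s = ⨆ a₁ : A₁, ∑ a₂, π₂ h s a₂ *
        (R h s (a₁, a₂) + ∑ s', P h s (a₁, a₂) s' * Vd (h + 1) s'))
    (Q : ℕ → S → A₁ × A₂ → ℝ)
    (Vup : ℕ → S → ℝ)
    (hVupH : ∀ s, Vup H s = 0)
    (hVup : ∀ h < H, ∀ s,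
      Vup h s = ⨆ a₁ : A₁, ∑ a₂, π₂ h s a₂ * Q h s (a₁, a₂))
    (hQ : ∀ h < H, ∀ s a₁ a₂,
      R h s (a₁, a₂) + ∑ s', P h s (a₁, a₂) s' * Vup (h + 1) s' ≤ Q h s (a₁, a₂)) :
    ∀ h ≤ H, ∀ s, Vd h s ≤ Vup h s := by
  intro h hh
  induction hh using Nat.decreasingInduction with
  | self => intro s; rw [hVdH, hVupH]
  | of_succ k hk ih =>
    intro s
    rw [hVd k hk, hVup k hk]
    refine ciSup_mono (Set.finite_range _).bddAbove fun a₁ => ?_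
    refine Finset.sum_le_sum fun a₂ _ => mul_le_mul_of_nonneg_left ?_ ((hπ₂ k hk s).1 a₂)
    refine le_trans ?_ (hQ k hk s a₁ a₂)
    gcongr with s'
    · exact (hP k hk s (a₁, a₂)).1 s'
    · exact ih s'
end

section
/- Consider a finite-horizon Markov decision process and its value functions V_h as defined in the context. Let c ≥ 0, suppose Q̲_h : S → A → ℝ are given for h < H, define V̲_H(s) = 0 and V̲_h(s) = E_{a∼π_h(s)}[Q̲_h(s,a)], and assume that for all h < H, s ∈ S, a ∈ A, R_h(s,a) + E_{s'∼P_h(s,a)}[V̲_{h+1}(s')] − c ≤ Q̲_h(s,a) ≤ R_h(s,a) + E_{s'∼P_h(s,a)}[V̲_{h+1}(s')]. Then 0 ≤ V_h(s) − V̲_h(s) ≤ (H − h)·c for every h ≤ H and every s ∈ S. -/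
/-- A weighted average of values lying in `[l, u]` lies in `[l, u]`. -/
theorem sum_mul_mem_Icc_of_sum_eq_one {ι : Type*} [Fintype ι] {w f : ι → ℝ} {l u : ℝ}
    (hw : (∀ i, 0 ≤ w i) ∧ ∑ i, w i = 1) (hf : ∀ i, f i ∈ Set.Icc l u) :
    ∑ i, w i * f i ∈ Set.Icc l u :=
  (convex_Icc l u).sum_mem (fun i _ => hw.1 i) hw.2 fun i _ => hf i

/-- The difference between the true values and pessimistic value estimates whose
per-step reward-plus-Bellman error is at most `c` is between `0` and `(H - h) * c`. -/
theorem stmt_4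
    {S A : Type*} [Fintype S] [Fintype A] [Nonempty S] [Nonempty A]
    (H : ℕ)
    (P : ℕ → S → A → S → ℝ) (R : ℕ → S → A → ℝ) (π : ℕ → S → A → ℝ)
    (hP : ∀ h < H, ∀ s a, (∀ s', 0 ≤ P h s a s') ∧ ∑ s', P h s a s' = 1)
    (hπ : ∀ h < H, ∀ s, (∀ a, 0 ≤ π h s a) ∧ ∑ a, π h s a = 1)
    (V : ℕ → S → ℝ)
    (hVH : ∀ s, V H s = 0)
    (hV : ∀ h < H, ∀ s,
      V h s = ∑ a, π h s a * (R h s a + ∑ s', P h s a s' * V (h + 1) s'))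
    (c : ℝ) (hc : 0 ≤ c)
    (Q : ℕ → S → A → ℝ)
    (Vlow : ℕ → S → ℝ)
    (hVlowH : ∀ s, Vlow H s = 0)
    (hVlow : ∀ h < H, ∀ s, Vlow h s = ∑ a, π h s a * Q h s a)
    (hQ : ∀ h < H, ∀ s a,
      R h s a + (∑ s', P h s a s' * Vlow (h + 1) s') - c ≤ Q h s a ∧
      Q h s a ≤ R h s a + ∑ s', P h s a s' * Vlow (h + 1) s') :
    ∀ h ≤ H, ∀ s, 0 ≤ V h s - Vlow h s ∧ V h s - Vlow h s ≤ ((H - h : ℕ) : ℝ) * c := by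
  intro h hh
  induction hh using Nat.decreasingInduction with
  | self => simp [hVH, hVlowH]
  | of_succ h hlt ih =>
    intro s
    have hcast : ((H - h : ℕ) : ℝ) = ((H - (h + 1) : ℕ) : ℝ) + 1 := by
      rw [← Nat.cast_succ]
      congr 1
      omega
    rw [hV h hlt, hVlow h hlt, ← Finset.sum_sub_distrib]
    simp_rw [← mul_sub]
    refine sum_mul_mem_Icc_of_sum_eq_one (hπ h hlt s) fun a => ?_
    obtain ⟨hl, hu⟩ := sum_mul_mem_Icc_of_sum_eq_one (hP h hlt s a) ih
    simp only [mul_sub, Finset.sum_sub_distrib] at hl hu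
    obtain ⟨hQl, hQu⟩ := hQ h hlt s a
    rw [hcast, add_one_mul]
    constructor <;> linarith
end

section
/- Consider a finite-horizon Markov decision process and its value functions V_h as defined in the context. Let Γ_h : S → A → ℝ be nonnegative bonus functions for h < H, and define the expected cumulative bonuses G_H(s) = 0, G_h(s) = E_{a∼π_h(s)}[Γ_h(s,a) + E_{s'∼P_h(s,a)}[G_{h+1}(s')]]. Suppose Q̲_h : S → A → ℝ are given, define V̲_H(s) = 0 and V̲_h(s) = E_{a∼π_h(s)}[Q̲_h(s,a)], and assume that for all h < H, s ∈ S, a ∈ A, R_h(s,a) + E_{s'∼P_h(s,a)}[V̲_{h+1}(s')] − 2·Γ_h(s,a) ≤ Q̲_h(s,a) ≤ R_h(s,a) + E_{s'∼P_h(s,a)}[V̲_{h+1}(s')]. Then 0 ≤ V_h(s) − V̲_h(s) ≤ 2·G_h(s) for every h ≤ H and every s ∈ S. -/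
/-- Telescoping bonus bound: if the Bellman errors of pessimistic Q-estimates are
between `0` and `2 Γ_h(s,a)`, then the value-estimation error is between `0` and
twice the expected cumulative bonus `G_h` along the policy's trajectories. -/
theorem stmt_5
    {S A : Type*} [Fintype S] [Fintype A] [Nonempty S] [Nonempty A]
    (H : ℕ)
    (P : ℕ → S → A → S → ℝ) (R : ℕ → S → A → ℝ) (π : ℕ → S → A → ℝ)
    (hP : ∀ h < H, ∀ s a, (∀ s', 0 ≤ P h s a s') ∧ ∑ s', P h s a s' = 1)
    (hπ : ∀ h < H, ∀ s, (∀ a, 0 ≤ π h s a) ∧ ∑ a, π h s a = 1)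
    (V : ℕ → S → ℝ)
    (hVH : ∀ s, V H s = 0)
    (hV : ∀ h < H, ∀ s,
      V h s = ∑ a, π h s a * (R h s a + ∑ s', P h s a s' * V (h + 1) s'))
    (Γ : ℕ → S → A → ℝ)
    (hΓ : ∀ h < H, ∀ s a, 0 ≤ Γ h s a)
    (G : ℕ → S → ℝ)
    (hGH : ∀ s, G H s = 0)
    (hG : ∀ h < H, ∀ s,
      G h s = ∑ a, π h s a * (Γ h s a + ∑ s', P h s a s' * G (h + 1) s'))
    (Q : ℕ → S → A → ℝ)
    (Vlow : ℕ → S → ℝ)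
    (hVlowH : ∀ s, Vlow H s = 0)
    (hVlow : ∀ h < H, ∀ s, Vlow h s = ∑ a, π h s a * Q h s a)
    (hQ : ∀ h < H, ∀ s a,
      R h s a + (∑ s', P h s a s' * Vlow (h + 1) s') - 2 * Γ h s a ≤ Q h s a ∧
      Q h s a ≤ R h s a + ∑ s', P h s a s' * Vlow (h + 1) s') :
    ∀ h ≤ H, ∀ s, 0 ≤ V h s - Vlow h s ∧ V h s - Vlow h s ≤ 2 * G h s := by
  intro h hh
  induction hh using Nat.decreasingInduction with
  | self => intro s; simp [hVH, hVlowH, hGH]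
  | of_succ h hlt ih =>
    intro s
    rw [hV h hlt, hVlow h hlt, hG h hlt, Finset.mul_sum, ← Finset.sum_sub_distrib]
    have lower (a : A) :
        ∑ s', P h s a s' * Vlow (h + 1) s' ≤ ∑ s', P h s a s' * V (h + 1) s' :=
      Finset.sum_le_sum fun s' _ =>
        mul_le_mul_of_nonneg_left (sub_nonneg.mp (ih s').1) ((hP h hlt s a).1 s')
    have upper (a : A) :
        ∑ s', P h s a s' * V (h + 1) s' ≤
          ∑ s', P h s a s' * Vlow (h + 1) s' + 2 * ∑ s', P h s a s' * G (h + 1) s' := by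
      rw [Finset.mul_sum, ← Finset.sum_add_distrib]
      refine Finset.sum_le_sum fun s' _ => ?_
      have := mul_le_mul_of_nonneg_left (ih s').2 ((hP h hlt s a).1 s')
      linarith
    constructor
    · refine Finset.sum_nonneg fun a _ => ?_
      rw [← mul_sub]
      exact mul_nonneg ((hπ h hlt s).1 a) (by linarith [lower a, (hQ h hlt s a).2])
    · refine Finset.sum_le_sum fun a _ => ?_
      rw [← mul_sub, mul_left_comm]
      exact mul_le_mul_of_nonneg_left (by linarith [upper a, (hQ h hlt s a).1])
        ((hπ h hlt s).1 a)
end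

section
/- Let d ∈ ℕ, let Ω be a finite nonempty set, let p : Ω → ℝ be nonnegative weights with ∑_{ω∈Ω} p(ω) = 1, and let φ : Ω → ℝ^d satisfy ‖φ(ω)‖₂ ≤ 1 for all ω. Let Σ_π = ∑_{ω} p(ω)·φ(ω)φ(ω)ᵀ, and let Σ be a d × d real symmetric positive semidefinite matrix such that Σ − C·Σ_π is positive semidefinite for some C > 0. Then for every λ > 0, ∑_{ω} p(ω)·√(φ(ω)ᵀ (Σ + λ·I)⁻¹ φ(ω)) ≤ √(d/C). -/
open Matrix

open scoped ComplexOrder MatrixOrder in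
/-- The trace of a product of two positive semidefinite matrices is nonnegative. -/
lemma Matrix.PosSemidef.trace_mul_nonneg {n 𝕜 : Type*} [Fintype n] [RCLike 𝕜]
    {A B : Matrix n n 𝕜} (hA : A.PosSemidef) (hB : B.PosSemidef) : 0 ≤ (A * B).trace := by
  classical
  obtain ⟨S, rfl⟩ := CStarAlgebra.nonneg_iff_eq_star_mul_self.mp hA.nonneg
  rw [Matrix.mul_assoc, Matrix.trace_mul_comm]
  exact (hB.mul_mul_conjTranspose_same S).trace_nonneg

/-- Jensen's inequality for the square root and finite probability weights. -/
lemma Finset.sum_mul_sqrt_le_sqrt_sum_mul {ι : Type*} (s : Finset ι) {p q : ι → ℝ}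
    (hp : ∀ i ∈ s, 0 ≤ p i) (hp1 : ∑ i ∈ s, p i = 1) (hq : ∀ i ∈ s, 0 ≤ q i) :
    ∑ i ∈ s, p i * √(q i) ≤ √(∑ i ∈ s, p i * q i) := by
  refine Real.le_sqrt_of_sq_le ?_
  have h := Finset.sum_sq_le_sum_mul_sum_of_sq_le_mul s (r := fun i => p i * √(q i)) hp
    (fun i hi => mul_nonneg (hp i hi) (hq i hi)) fun i hi => le_of_eq <| by
      rw [mul_pow, Real.sq_sqrt (hq i hi), sq, mul_assoc]
  rwa [hp1, one_mul] at h

/-- Bound on the expected sum of bonuses under relative (unilateral) coverage: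
if the behavior covariance `Σ` dominates `C` times the occupancy second-moment
matrix `Σπ` of unit-norm features, then the expected `(Σ + λ I)⁻¹`-weighted norm
of the features is at most `√(d / C)`. -/
theorem stmt_14 (d : ℕ) {Ω : Type*} [Fintype Ω] [Nonempty Ω]
    (p : Ω → ℝ) (hp0 : ∀ ω, 0 ≤ p ω) (hp1 : ∑ ω, p ω = 1)
    (φ : Ω → Fin d → ℝ) (hφ : ∀ ω, Real.sqrt (∑ j, φ ω j ^ 2) ≤ 1)
    (Sigπ : Matrix (Fin d) (Fin d) ℝ)
    (hSigπ : Sigπ = ∑ ω, p ω • Matrix.vecMulVec (φ ω) (φ ω))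
    (Sig : Matrix (Fin d) (Fin d) ℝ) (hSig : Sig.PosSemidef)
    (C : ℝ) (hC : 0 < C) (hcov : (Sig - C • Sigπ).PosSemidef)
    (lam : ℝ) (hlam : 0 < lam) :
    ∑ ω, p ω * Real.sqrt (φ ω ⬝ᵥ
        ((Sig + lam • (1 : Matrix (Fin d) (Fin d) ℝ))⁻¹).mulVec (φ ω)) ≤
      Real.sqrt ((d : ℝ) / C) := by
  have hA : (Sig + lam • (1 : Matrix (Fin d) (Fin d) ℝ)).PosDef :=
    PosDef.posSemidef_add hSig (PosDef.one.smul hlam)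
  set A := Sig + lam • (1 : Matrix (Fin d) (Fin d) ℝ) with hA_def
  have hAinv := hA.inv.posSemidef
  have hgap : (A - C • Sigπ).PosSemidef := by
    rw [hA_def, add_sub_right_comm]
    exact hcov.add (PosSemidef.one.smul hlam.le)
  have htrace : (A⁻¹ * Sigπ).trace = ∑ ω, p ω * (φ ω ⬝ᵥ A⁻¹ *ᵥ φ ω) := by
    rw [hSigπ, Matrix.mul_sum, trace_sum]
    refine Finset.sum_congr rfl fun ω _ => ?_
    rw [Matrix.mul_smul, trace_smul, mul_vecMulVec, trace_vecMulVec, dotProduct_comm, smul_eq_mul]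
  have hbound : C * (A⁻¹ * Sigπ).trace ≤ d := by
    have h := hAinv.trace_mul_nonneg hgap
    rw [Matrix.mul_sub, nonsing_inv_mul _ ((isUnit_iff_isUnit_det A).mp hA.isUnit), trace_sub,
      trace_one, Matrix.mul_smul, trace_smul, smul_eq_mul, Fintype.card_fin] at h
    linarith
  refine (Finset.univ.sum_mul_sqrt_le_sqrt_sum_mul (fun ω _ => hp0 ω) hp1 fun ω _ => ?_).trans
    (Real.sqrt_le_sqrt ?_)
  · simpa using hAinv.dotProduct_mulVec_nonneg (φ ω)
  · rwa [← htrace, le_div_iff₀' hC]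
end
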